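/- arXiv:1707.01705 — 3 statements merged into one kernel-verified Lean document; each statement's English description precedes it below -/
import Mathlib

section
/- Let x > 0 and let p be C⁴-bounded on (0,∞). Then α₂(x,h) := E[(ξ_{x,h} − x)² p(ξ_{x,h})] satisfies α₂(x,h) = p(x)(x h + 2h²) + O(h²) as h → 0⁺. -/
open Real Filter Set MeasureTheory

/-- The Gamma kernel with shape `α` and scale `θ`:
`K_{G(α,θ)}(u) = u^{α−1} e^{−u/θ} / (θ^α Γ(α))`. -/
noncomputable def gammaKernel (α θ u : ℝ) : ℝ :=
  u ^ (α - 1) * Real.exp (-u / θ) / (θ ^ α * Real.Gamma α)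

/-- `E[f(ξ_{x,h})] = ∫₀^∞ f(u) K_{G(x/h+1,h)}(u) du`. -/
noncomputable def Egamma (x h : ℝ) (f : ℝ → ℝ) : ℝ :=
  ∫ u in Set.Ioi (0:ℝ), f u * gammaKernel (x / h + 1) h u

/-- A function is C⁴-bounded on `(0,∞)` if it is four times continuously differentiable
there and it, together with its first four derivatives, is bounded there. -/
def C4Bounded (p : ℝ → ℝ) : Prop :=
  ContDiffOn ℝ 4 p (Set.Ioi 0) ∧
    ∀ k : ℕ, k ≤ 4 → ∃ C, ∀ u ∈ Set.Ioi (0:ℝ),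
      |iteratedDerivWithin k p (Set.Ioi 0) u| ≤ C

theorem gk_moment (x h : ℝ) (hx : 0 < x) (hh : 0 < h) (k : ℕ) :
    IntegrableOn (fun u => u ^ k * gammaKernel (x / h + 1) h u) (Set.Ioi 0) ∧
    ∫ u in Set.Ioi (0:ℝ), u ^ k * gammaKernel (x / h + 1) h u
      = ∏ i ∈ Finset.range k, (x + (i + 1) * h) := by
  have hxh : 0 < x / h := by positivity
  have hG : 0 < Real.Gamma (x / h + 1) := Real.Gamma_pos_of_pos (by positivity)
  have hP : 0 < h ^ (x / h + 1) := by positivity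
  have key : ∀ u ∈ Set.Ioi (0:ℝ), (h ^ (x / h + 1) * Real.Gamma (x / h + 1))⁻¹ *
      (u ^ ((x / h + 1 + k) - 1) * Real.exp (-(h⁻¹ * u)))
      = u ^ k * gammaKernel (x / h + 1) h u := by
    intro u hu
    have hu' : (0:ℝ) < u := hu
    unfold gammaKernel
    rw [show x / h + 1 + (k:ℝ) - 1 = (x / h + 1 - 1) + k by ring, Real.rpow_add hu',
      Real.rpow_natCast, show -(h⁻¹ * u) = -u / h by ring]
    ring
  constructor
  · have h1 := integrableOn_rpow_mul_exp_neg_mul_rpow (p := 1) (s := (x / h + 1 + k) - 1)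
      (b := h⁻¹) (by have : (0:ℝ) ≤ k := Nat.cast_nonneg k
                     linarith) one_pos (by positivity)
    have h2 : IntegrableOn (fun u => (h ^ (x / h + 1) * Real.Gamma (x / h + 1))⁻¹ *
      (u ^ ((x / h + 1 + k) - 1) * Real.exp (-(h⁻¹ * u)))) (Set.Ioi 0) := by
      have := h1.const_mul ((h ^ (x / h + 1) * Real.Gamma (x / h + 1))⁻¹)
      simpa [IntegrableOn] using this
    exact h2.congr_fun key measurableSet_Ioi
  · rw [← setIntegral_congr_fun measurableSet_Ioi key, integral_const_mul,
      Real.integral_rpow_mul_exp_neg_mul_Ioi (by positivity) (by positivity)]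
    rw [one_div, inv_inv, Real.rpow_add hh (x / h + 1) k, Real.rpow_natCast]
    have hgam : Real.Gamma (x / h + 1 + k) * h ^ k
        = Real.Gamma (x / h + 1) * ∏ i ∈ Finset.range k, (x + (i + 1) * h) := by
      clear key
      induction k with
      | zero => simp
      | succ n ih =>
        rw [Finset.prod_range_succ, ← mul_assoc, ← ih]
        push_cast
        rw [← add_assoc, Real.Gamma_add_one (by positivity)]
        field_simp
        ring
    rw [inv_mul_eq_iff_eq_mul₀ (by positivity), mul_assoc, mul_assoc, ← hgam]
    ring

theorem gk_poly (x h : ℝ) (hx : 0 < x) (hh : 0 < h) (n : ℕ) (a : ℕ → ℝ) :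
    IntegrableOn (fun u => (∑ k ∈ Finset.range n, a k * u ^ k) * gammaKernel (x / h + 1) h u)
      (Set.Ioi 0) ∧
    ∫ u in Set.Ioi (0:ℝ), (∑ k ∈ Finset.range n, a k * u ^ k) * gammaKernel (x / h + 1) h u
      = ∑ k ∈ Finset.range n, a k * ∏ i ∈ Finset.range k, (x + (i + 1) * h) := by
  simp only [Finset.sum_mul, mul_assoc]
  constructor
  · exact integrable_finsetSum _ fun k _ => ((gk_moment x h hx hh k).1.const_mul (a k))
  · rw [integral_finsetSum _ fun k _ => ((gk_moment x h hx hh k).1.const_mul (a k))]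
    refine Finset.sum_congr rfl fun k _ => ?_
    rw [integral_const_mul, (gk_moment x h hx hh k).2]

theorem gk_two (x h : ℝ) (hx : 0 < x) (hh : 0 < h) :
    IntegrableOn (fun u => (u - x) ^ 2 * gammaKernel (x / h + 1) h u) (Set.Ioi 0) ∧
    ∫ u in Set.Ioi (0:ℝ), (u - x) ^ 2 * gammaKernel (x / h + 1) h u = x * h + 2 * h ^ 2 := by
  have := gk_poly x h hx hh 3 (fun k => if k = 0 then x ^ 2 else if k = 1 then - 2 * x else 1)
  simp only [Finset.sum_range_succ, Finset.prod_range_succ, Finset.sum_range_zero,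
    Finset.prod_range_zero] at this
  norm_num at this
  have e : ∀ u : ℝ, (u - x) ^ 2 = x ^ 2 + - (2 * x * u) + u ^ 2 := fun u => by ring
  simp only [e]
  refine ⟨this.1, this.2.trans (by ring)⟩

theorem gk_three (x h : ℝ) (hx : 0 < x) (hh : 0 < h) :
    IntegrableOn (fun u => (u - x) ^ 3 * gammaKernel (x / h + 1) h u) (Set.Ioi 0) ∧
    ∫ u in Set.Ioi (0:ℝ), (u - x) ^ 3 * gammaKernel (x / h + 1) h u
      = 5 * x * h ^ 2 + 6 * h ^ 3 := by
  have := gk_poly x h hx hh 4 (fun k => if k = 0 then - x ^ 3 else if k = 1 then 3 * x ^ 2 else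
    if k = 2 then - 3 * x else 1)
  simp only [Finset.sum_range_succ, Finset.prod_range_succ, Finset.sum_range_zero,
    Finset.prod_range_zero] at this
  norm_num at this
  have e : ∀ u : ℝ, (u - x) ^ 3 = - x ^ 3 + 3 * x ^ 2 * u + - (3 * x * u ^ 2) + u ^ 3 :=
    fun u => by ring
  simp only [e]
  refine ⟨this.1, this.2.trans (by ring)⟩

theorem gk_four (x h : ℝ) (hx : 0 < x) (hh : 0 < h) :
    IntegrableOn (fun u => (u - x) ^ 4 * gammaKernel (x / h + 1) h u) (Set.Ioi 0) ∧
    ∫ u in Set.Ioi (0:ℝ), (u - x) ^ 4 * gammaKernel (x / h + 1) h u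
      = 3 * x ^ 2 * h ^ 2 + 26 * x * h ^ 3 + 24 * h ^ 4 := by
  have := gk_poly x h hx hh 5 (fun k => if k = 0 then x ^ 4 else if k = 1 then - 4 * x ^ 3 else
    if k = 2 then 6 * x ^ 2 else if k = 3 then - 4 * x else 1)
  simp only [Finset.sum_range_succ, Finset.prod_range_succ, Finset.sum_range_zero,
    Finset.prod_range_zero] at this
  norm_num at this
  have e : ∀ u : ℝ, (u - x) ^ 4 = x ^ 4 + - (4 * x ^ 3 * u) + 6 * x ^ 2 * u ^ 2
    + - (4 * x * u ^ 3) + u ^ 4 := fun u => by ring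
  simp only [e]
  refine ⟨this.1, this.2.trans (by ring)⟩

theorem taylor_bound (x : ℝ) (hx : 0 < x) (p : ℝ → ℝ) (hp : C4Bounded p) :
    ∃ d M : ℝ, 0 ≤ M ∧ ∀ u ∈ Set.Ioi (0:ℝ), |p u - p x - d * (u - x)| ≤ M * (u - x) ^ 2 := by
  obtain ⟨hc, hb⟩ := hp
  obtain ⟨M, hM⟩ := hb 2 (by norm_num)
  have hu := uniqueDiffOn_Ioi (0:ℝ)
  have hM0 : 0 ≤ M := (abs_nonneg _).trans (hM x hx)
  have hd1 : DifferentiableOn ℝ (derivWithin p (Set.Ioi 0)) (Set.Ioi 0) := by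
    have := hc.differentiableOn_iteratedDerivWithin (m := 1) (by norm_num) hu
    rwa [iteratedDerivWithin_one] at this
  have hd0 : DifferentiableOn ℝ p (Set.Ioi 0) := hc.differentiableOn (by norm_num)
  have hM' : ∀ u ∈ Set.Ioi (0:ℝ), ‖derivWithin (derivWithin p (Set.Ioi 0)) (Set.Ioi 0) u‖ ≤ M := by
    intro u hu
    have := hM u hu
    rwa [show 2 = 1 + 1 from rfl, iteratedDerivWithin_succ, iteratedDerivWithin_one] at this
  have hl : ∀ t ∈ Set.Ioi (0:ℝ),
      ‖derivWithin p (Set.Ioi 0) t - derivWithin p (Set.Ioi 0) x‖ ≤ M * ‖t - x‖ := fun t ht =>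
    (convex_Ioi 0).norm_image_sub_le_of_norm_derivWithin_le hd1 hM' hx ht
  refine ⟨derivWithin p (Set.Ioi 0) x, M, hM0, fun u hu0 => ?_⟩
  have hsub : Set.uIcc x u ⊆ Set.Ioi 0 := fun t ht => lt_of_lt_of_le (lt_min hx hu0) ht.1
  have := (convex_uIcc x u).norm_image_sub_le_of_norm_hasDerivWithin_le
    (f := fun t => p t - derivWithin p (Set.Ioi 0) x * t)
    (f' := fun t => derivWithin p (Set.Ioi 0) t - derivWithin p (Set.Ioi 0) x)
    (C := M * |u - x|) (x := x) (y := u) (𝕜 := ℝ)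
    (fun t ht => by
      have h1 := ((hd0 t (hsub ht)).hasDerivWithinAt).mono hsub
      have h2 := (hasDerivWithinAt_id t (Set.uIcc x u)).const_mul (derivWithin p (Set.Ioi 0) x)
      have h3 := h1.sub h2
      rw [mul_one] at h3
      exact h3)
    (fun t ht => (hl t (hsub ht)).trans
      (mul_le_mul_of_nonneg_left (Set.abs_sub_left_of_mem_uIcc ht) hM0))
    Set.left_mem_uIcc Set.right_mem_uIcc
  rw [Real.norm_eq_abs, Real.norm_eq_abs, mul_assoc, abs_mul_abs_self] at this
  calc _ = |p u - derivWithin p (Set.Ioi 0) x * u - (p x - derivWithin p (Set.Ioi 0) x * x)| := by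
        congr 1; ring
    _ ≤ _ := this
    _ = _ := by ring

/-- For `x > 0` and `p` C⁴-bounded on `(0,∞)`,
`α₂(x,h) = E[(ξ_{x,h} − x)² p(ξ_{x,h})] = p(x)(xh + 2h²) + O(h²)` as `h → 0⁺`. -/
theorem alpha2_expansion (x : ℝ) (hx : 0 < x) (p : ℝ → ℝ) (hp : C4Bounded p) :
    ∃ C > 0, ∃ h₀ > 0, ∀ h : ℝ, 0 < h → h < h₀ →
      |Egamma x h (fun u => (u - x) ^ 2 * p u) - p x * (x * h + 2 * h ^ 2)|
        ≤ C * h ^ 2 := by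
  obtain ⟨d, M, hM0, hT⟩ := taylor_bound x hx p hp
  refine ⟨|d| * (5 * x + 6) + M * (3 * x ^ 2 + 26 * x + 24) + 1, by positivity, 1, one_pos,
    fun h hh hh1 => ?_⟩
  obtain ⟨i2, m2⟩ := gk_two x h hx hh
  obtain ⟨i3, m3⟩ := gk_three x h hx hh
  obtain ⟨i4, m4⟩ := gk_four x h hx hh
  have hK : ∀ u ∈ Set.Ioi (0:ℝ), 0 ≤ gammaKernel (x / h + 1) h u := by
    intro u hu
    have hu' : (0:ℝ) < u := hu
    have hG : 0 < Real.Gamma (x / h + 1) := Real.Gamma_pos_of_pos (by positivity)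
    unfold gammaKernel
    positivity
  have iK : IntegrableOn (fun u => gammaKernel (x / h + 1) h u) (Set.Ioi 0) := by
    simpa using (gk_moment x h hx hh 0).1
  have hbd : ∀ᵐ u ∂(volume.restrict (Set.Ioi (0:ℝ))),
      ‖(p u - p x - d * (u - x)) * ((u - x) ^ 2 * gammaKernel (x / h + 1) h u)‖
        ≤ M * ((u - x) ^ 4 * gammaKernel (x / h + 1) h u) := by
    refine (ae_restrict_iff' measurableSet_Ioi).2 (ae_of_all _ fun u hu => ?_)
    have hn : 0 ≤ (u - x) ^ 2 * gammaKernel (x / h + 1) h u := mul_nonneg (sq_nonneg _) (hK u hu)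
    rw [norm_mul, Real.norm_eq_abs, Real.norm_of_nonneg hn]
    calc _ ≤ M * (u - x) ^ 2 * ((u - x) ^ 2 * gammaKernel (x / h + 1) h u) :=
          mul_le_mul_of_nonneg_right (hT u hu) hn
      _ = _ := by ring
  have hpm : AEStronglyMeasurable (fun u => p u - p x - d * (u - x))
      (volume.restrict (Set.Ioi (0:ℝ))) := by
    refine ContinuousOn.aestronglyMeasurable ?_ measurableSet_Ioi
    exact (hp.1.continuousOn.sub continuousOn_const).sub (by fun_prop)
  have iR : Integrable (fun u =>
      (p u - p x - d * (u - x)) * ((u - x) ^ 2 * gammaKernel (x / h + 1) h u))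
      (volume.restrict (Set.Ioi (0:ℝ))) := Integrable.mono' (i4.const_mul M) (hpm.mul i2.aestronglyMeasurable) hbd
  have hR := norm_integral_le_of_norm_le (i4.const_mul M) hbd
  rw [integral_const_mul, m4, Real.norm_eq_abs] at hR
  have i23 : Integrable (fun u => p x * ((u - x) ^ 2 * gammaKernel (x / h + 1) h u)
      + d * ((u - x) ^ 3 * gammaKernel (x / h + 1) h u))
      (volume.restrict (Set.Ioi (0:ℝ))) := (i2.const_mul _).add (i3.const_mul _)
  have hE : Egamma x h (fun u => (u - x) ^ 2 * p u) = p x * (x * h + 2 * h ^ 2)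
      + d * (5 * x * h ^ 2 + 6 * h ^ 3)
      + ∫ u in Set.Ioi (0:ℝ),
        (p u - p x - d * (u - x)) * ((u - x) ^ 2 * gammaKernel (x / h + 1) h u) := by
    rw [← m2, ← m3, ← integral_const_mul, ← integral_const_mul,
      ← integral_add (i2.const_mul _) (i3.const_mul _),
      ← integral_add i23 iR]
    unfold Egamma
    congr 1
    ext u
    ring
  rw [hE]
  set R := ∫ u in Set.Ioi (0:ℝ),
        (p u - p x - d * (u - x)) * ((u - x) ^ 2 * gammaKernel (x / h + 1) h u)
  have h3 : h ^ 3 ≤ h ^ 2 := pow_le_pow_of_le_one hh.le hh1.le (by norm_num)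
  have h4 : h ^ 4 ≤ h ^ 2 := pow_le_pow_of_le_one hh.le hh1.le (by norm_num)
  calc _ = |d * (5 * x * h ^ 2 + 6 * h ^ 3) + R| := by congr 1; ring
    _ ≤ |d| * (5 * x * h ^ 2 + 6 * h ^ 3) + |R| := by
      refine (abs_add_le _ _).trans ?_
      rw [abs_mul, abs_of_nonneg (by positivity : 0 ≤ 5 * x * h ^ 2 + 6 * h ^ 3)]
    _ ≤ |d| * (5 * x * h ^ 2 + 6 * h ^ 2)
        + M * (3 * x ^ 2 * h ^ 2 + 26 * x * h ^ 2 + 24 * h ^ 2) := by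
      refine add_le_add ?_ (hR.trans ?_) <;> gcongr
    _ ≤ _ := by nlinarith [sq_nonneg h]
end

section
/- Let x > 0 and let p be C⁴-bounded on (0,∞). Then α₀(x,h)·α₂(x,h) − α₁(x,h)² = p(x)² x h + O(h²) as h → 0⁺. -/
open Real Filter Set MeasureTheory

lemma gk_pow (x h : ℝ) (hh : 0 < h) (k : ℕ) {u : ℝ} (hu : u ∈ Ioi (0:ℝ)) :
    u ^ k * gammaKernel (x / h + 1) h u =
      (u ^ ((x / h + 1 + k) - 1) * Real.exp (-(h⁻¹ * u))) *
        (h ^ (x / h + 1) * Real.Gamma (x / h + 1))⁻¹ := by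
  have hu' : (0:ℝ) < u := hu
  have e : (x / h + 1 + k) - 1 = (x / h + 1 - 1) + (k : ℝ) := by ring
  rw [gammaKernel, e, Real.rpow_add hu', Real.rpow_natCast]
  have : -u / h = -(h⁻¹ * u) := by field_simp
  rw [this]
  ring

lemma gk_int (x h : ℝ) (hx : 0 < x) (hh : 0 < h) (k : ℕ) :
    IntegrableOn (fun u => u ^ k * gammaKernel (x / h + 1) h u) (Ioi 0) := by
  rw [integrableOn_congr_fun (fun u hu => gk_pow x h hh k hu) measurableSet_Ioi]
  apply Integrable.mul_const
  have hxh : 0 < x / h := div_pos hx hh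
  have := integrableOn_rpow_mul_exp_neg_mul_rpow (p := 1) (s := (x / h + 1 + k) - 1) (b := h⁻¹)
    (by have : (0:ℝ) ≤ k := Nat.cast_nonneg k
        linarith) (by norm_num) (by positivity)
  simpa [IntegrableOn] using this

lemma gk_val (x h : ℝ) (hx : 0 < x) (hh : 0 < h) (k : ℕ) :
    ∫ u in Ioi (0:ℝ), u ^ k * gammaKernel (x / h + 1) h u =
      h ^ k * Real.Gamma (x / h + 1 + k) / Real.Gamma (x / h + 1) := by
  have hxh : 0 < x / h := div_pos hx hh
  rw [setIntegral_congr_fun measurableSet_Ioi (fun u hu => gk_pow x h hh k hu),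
    integral_mul_const, Real.integral_rpow_mul_exp_neg_mul_Ioi (by positivity) (by positivity)]
  have h1 : Real.Gamma (x / h + 1) ≠ 0 := (Real.Gamma_pos_of_pos (by positivity)).ne'
  have h2 : h ^ (x / h + 1) ≠ 0 := (Real.rpow_pos_of_pos hh _).ne'
  rw [one_div, inv_inv, Real.rpow_add hh, Real.rpow_natCast]
  field_simp

lemma gk_zero (x h : ℝ) (hx : 0 < x) (hh : 0 < h) :
    ∫ u in Ioi (0:ℝ), u ^ 0 * gammaKernel (x / h + 1) h u = 1 := by
  have hxh : 0 < x / h := div_pos hx hh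
  rw [gk_val x h hx hh]
  have h1 : Real.Gamma (x / h + 1) ≠ 0 := (Real.Gamma_pos_of_pos (by positivity)).ne'
  simp [h1]

lemma gk_succ (x h : ℝ) (hx : 0 < x) (hh : 0 < h) (k : ℕ) :
    ∫ u in Ioi (0:ℝ), u ^ (k + 1) * gammaKernel (x / h + 1) h u =
      (x + (k + 1) * h) * ∫ u in Ioi (0:ℝ), u ^ k * gammaKernel (x / h + 1) h u := by
  have hxh : 0 < x / h := div_pos hx hh
  rw [gk_val x h hx hh, gk_val x h hx hh]
  have e : x / h + 1 + ((k + 1 : ℕ) : ℝ) = (x / h + 1 + k) + 1 := by push_cast; ring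
  rw [e, Real.Gamma_add_one (by positivity)]
  have h1 : Real.Gamma (x / h + 1) ≠ 0 := (Real.Gamma_pos_of_pos (by positivity)).ne'
  field_simp
  ring

/-- Integrability and value for quartic polynomials. -/
lemma gk_poly_s13 (x h : ℝ) (hx : 0 < x) (hh : 0 < h) (f : ℝ → ℝ) (c0 c1 c2 c3 c4 : ℝ)
    (hf : ∀ u, f u = c0 + c1 * u + c2 * u ^ 2 + c3 * u ^ 3 + c4 * u ^ 4) :
    IntegrableOn (fun u => f u * gammaKernel (x / h + 1) h u) (Ioi 0) ∧
    Egamma x h f = c0 + c1 * (x + h) + c2 * ((x + h) * (x + 2 * h))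
      + c3 * ((x + h) * (x + 2 * h) * (x + 3 * h))
      + c4 * ((x + h) * (x + 2 * h) * (x + 3 * h) * (x + 4 * h)) := by
  have i0 := (gk_int x h hx hh 0).const_mul c0
  have i1 := (gk_int x h hx hh 1).const_mul c1
  have i2 := (gk_int x h hx hh 2).const_mul c2
  have i3 := (gk_int x h hx hh 3).const_mul c3
  have i4 := (gk_int x h hx hh 4).const_mul c4
  have m0 := gk_zero x h hx hh
  have m1 := gk_succ x h hx hh 0
  have m2 := gk_succ x h hx hh 1
  have m3 := gk_succ x h hx hh 2
  have m4 := gk_succ x h hx hh 3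
  norm_num only [zero_add, Nat.reduceAdd, Nat.cast_zero, Nat.cast_one, Nat.cast_ofNat] at m1 m2 m3 m4
  have e : (fun u => f u * gammaKernel (x / h + 1) h u) = fun u =>
      c0 * (u ^ 0 * gammaKernel (x / h + 1) h u) + c1 * (u ^ 1 * gammaKernel (x / h + 1) h u)
      + c2 * (u ^ 2 * gammaKernel (x / h + 1) h u) + c3 * (u ^ 3 * gammaKernel (x / h + 1) h u)
      + c4 * (u ^ 4 * gammaKernel (x / h + 1) h u) := by
    funext u; rw [hf]; ring
  refine ⟨?_, ?_⟩
  · rw [e]; exact (((i0.add i1).add i2).add i3).add i4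
  · rw [Egamma, e, integral_add (by exact ((i0.add i1).add i2).add i3) i4,
      integral_add (by exact (i0.add i1).add i2) i3, integral_add (by exact i0.add i1) i2,
      integral_add i0 i1]
    simp only [integral_const_mul]
    rw [m4, m3, m2]
    simp only [pow_one, pow_zero] at m1 m0 ⊢
    rw [m1, m0]
    ring

lemma gk_bound (x h : ℝ) (hx : 0 < x) (hh : 0 < h) (f q r : ℝ → ℝ)
    (hf : ContinuousOn f (Ioi 0))
    (hq : IntegrableOn (fun u => q u * gammaKernel (x / h + 1) h u) (Ioi 0))
    (hqc : Continuous q)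
    (hr : IntegrableOn (fun u => r u * gammaKernel (x / h + 1) h u) (Ioi 0))
    (hb : ∀ u ∈ Ioi (0:ℝ), |f u - q u| ≤ r u) :
    |Egamma x h f - Egamma x h q| ≤ Egamma x h r := by
  have hK : ∀ u ∈ Ioi (0:ℝ), 0 ≤ gammaKernel (x / h + 1) h u := by
    intro u hu
    have hu' : (0:ℝ) < u := hu
    have hxh : 0 < x / h := div_pos hx hh
    have h1 : 0 < Real.Gamma (x / h + 1) := Real.Gamma_pos_of_pos (by positivity)
    unfold gammaKernel
    positivity
  have hb' : ∀ u ∈ Ioi (0:ℝ), ‖(f u - q u) * gammaKernel (x / h + 1) h u‖ ≤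
      r u * gammaKernel (x / h + 1) h u := by
    intro u hu
    rw [norm_mul, Real.norm_eq_abs, Real.norm_eq_abs, abs_of_nonneg (hK u hu)]
    exact mul_le_mul_of_nonneg_right (hb u hu) (hK u hu)
  have hKm : AEStronglyMeasurable (gammaKernel (x / h + 1) h) (volume.restrict (Ioi (0:ℝ))) := by
    have := (gk_int x h hx hh 0).aestronglyMeasurable
    simpa using this
  have hd : IntegrableOn (fun u => (f u - q u) * gammaKernel (x / h + 1) h u) (Ioi 0) := by
    refine Integrable.mono' hr ?_ ?_
    · exact ((hf.sub hqc.continuousOn).aestronglyMeasurable measurableSet_Ioi).mul hKm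
    · exact (ae_restrict_mem measurableSet_Ioi).mono hb'
  have hfi : IntegrableOn (fun u => f u * gammaKernel (x / h + 1) h u) (Ioi 0) := by
    refine (hd.add hq).congr (Eventually.of_forall fun u => ?_)
    simp only [Pi.add_apply]; ring
  have e : Egamma x h f - Egamma x h q =
      ∫ u in Ioi (0:ℝ), (f u - q u) * gammaKernel (x / h + 1) h u := by
    unfold Egamma
    rw [← integral_sub hfi hq]
    congr 1; funext u; ring
  rw [e, ← Real.norm_eq_abs]
  exact norm_integral_le_of_norm_le hr ((ae_restrict_mem measurableSet_Ioi).mono hb')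

/-- First and second order Taylor bounds. -/
lemma taylor_bounds (x : ℝ) (hx : 0 < x) (p : ℝ → ℝ) (hp : C4Bounded p) :
    ∃ L M d : ℝ, 0 ≤ L ∧ 0 ≤ M ∧ ∀ u ∈ Ioi (0:ℝ), |p u - p x| ≤ L * |u - x| ∧
      |p u - p x - d * (u - x)| ≤ M * (u - x) ^ 2 := by
  obtain ⟨hc, hb⟩ := hp
  obtain ⟨L, hL⟩ := hb 1 (by norm_num)
  obtain ⟨M, hM⟩ := hb 2 (by norm_num)
  have hxm : x ∈ Ioi (0:ℝ) := hx
  have ud : UniqueDiffOn ℝ (Ioi (0:ℝ)) := uniqueDiffOn_Ioi 0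
  have hd0 : DifferentiableOn ℝ p (Ioi 0) := hc.differentiableOn (by norm_num)
  have hd1 : DifferentiableOn ℝ (iteratedDerivWithin 1 p (Ioi 0)) (Ioi 0) :=
    hc.differentiableOn_iteratedDerivWithin (by norm_cast) ud
  have D0 : ∀ u ∈ Ioi (0:ℝ), HasDerivWithinAt p (iteratedDerivWithin 1 p (Ioi 0) u) (Ioi 0) u := by
    intro u hu
    rw [iteratedDerivWithin_one]
    exact (hd0 u hu).hasDerivWithinAt
  have D1 : ∀ u ∈ Ioi (0:ℝ), HasDerivWithinAt (iteratedDerivWithin 1 p (Ioi 0))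
      (iteratedDerivWithin 2 p (Ioi 0) u) (Ioi 0) u := by
    intro u hu
    have e := iteratedDerivWithin_succ (n := 1) (f := p) (s := Ioi (0:ℝ))
    have := (hd1 u hu).hasDerivWithinAt
    rw [← congrFun e u] at this
    exact this
  have hL0 : 0 ≤ L := (abs_nonneg _).trans (hL x hxm)
  have hM0 : 0 ≤ M := (abs_nonneg _).trans (hM x hxm)
  refine ⟨L, M, iteratedDerivWithin 1 p (Ioi 0) x, hL0, hM0, fun u hu => ⟨?_, ?_⟩⟩
  · exact (convex_Ioi (0:ℝ)).norm_image_sub_le_of_norm_hasDerivWithin_le D0 hL hxm hu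
  · have sub : uIcc x u ⊆ Ioi (0:ℝ) := by
      intro t ht
      exact lt_of_lt_of_le (lt_min hx hu) ht.1
    have key := (convex_uIcc x u).norm_image_sub_le_of_norm_hasDerivWithin_le
      (f := fun t => p t - p x - iteratedDerivWithin 1 p (Ioi 0) x * (t - x))
      (f' := fun t => iteratedDerivWithin 1 p (Ioi 0) t - iteratedDerivWithin 1 p (Ioi 0) x)
      (C := M * |u - x|) (x := x) (y := u) ?_ ?_ left_mem_uIcc right_mem_uIcc
    · simp only [sub_self, mul_zero, sub_zero, Real.norm_eq_abs] at key
      calc _ ≤ _ := key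
        _ = M * (u - x) ^ 2 := by rw [mul_assoc, ← sq, sq_abs]
    · intro t ht
      have h1 := ((D0 t (sub ht)).mono sub).sub_const (p x)
      have h2 := (((hasDerivWithinAt_id t (uIcc x u)).sub_const x).const_mul
        (iteratedDerivWithin 1 p (Ioi 0) x))
      have h3 := h1.sub h2
      rw [mul_one] at h3
      exact h3
    · intro t ht
      have h1 := (convex_Ioi (0:ℝ)).norm_image_sub_le_of_norm_hasDerivWithin_le D1 hM hxm (sub ht)
      refine h1.trans ?_
      exact mul_le_mul_of_nonneg_left (abs_sub_left_of_mem_uIcc ht) hM0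

/-- For `x > 0` and `p` C⁴-bounded on `(0,∞)`, the limiting denominator of the
Gamma-kernel local linear estimator satisfies
`α₀(x,h)·α₂(x,h) − α₁(x,h)² = p(x)² x h + O(h²)` as `h → 0⁺`. -/
theorem denominator_expansion (x : ℝ) (hx : 0 < x) (p : ℝ → ℝ) (hp : C4Bounded p) :
    ∃ C > 0, ∃ h₀ > 0, ∀ h : ℝ, 0 < h → h < h₀ →
      |Egamma x h p * Egamma x h (fun u => (u - x) ^ 2 * p u) -
          (Egamma x h (fun u => (u - x) * p u)) ^ 2 - p x ^ 2 * x * h| ≤ C * h ^ 2 := by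
  obtain ⟨L, M, d, hL, hM, hT⟩ := taylor_bounds x hx p hp
  have hpc : ContinuousOn p (Ioi 0) := hp.1.continuousOn
  set a := p x with ha
  -- the three estimates
  have A0 : ∀ h : ℝ, 0 < h → |Egamma x h p - (a + d * h)| ≤ M * (x * h + 2 * h ^ 2) := by
    intro h hh
    obtain ⟨iq, vq⟩ := gk_poly_s13 x h hx hh (fun u => a + d * (u - x)) (a - d * x) d 0 0 0
      (fun u => by ring)
    obtain ⟨ir, vr⟩ := gk_poly_s13 x h hx hh (fun u => M * (u - x) ^ 2) (M * x ^ 2) (-2 * M * x) M 0 0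
      (fun u => by ring)
    have := gk_bound x h hx hh p _ _ hpc iq (by fun_prop) ir (fun u hu => by
      have := (hT u hu).2
      rwa [show p u - (a + d * (u - x)) = p u - a - d * (u - x) by ring])
    rw [vq, vr] at this
    convert this using 1
    · congr 1; ring
    · ring
  have A1 : ∀ h : ℝ, 0 < h → |Egamma x h (fun u => (u - x) * p u) - a * h| ≤
      L * (x * h + 2 * h ^ 2) := by
    intro h hh
    obtain ⟨iq, vq⟩ := gk_poly_s13 x h hx hh (fun u => a * (u - x)) (- a * x) a 0 0 0
      (fun u => by ring)
    obtain ⟨ir, vr⟩ := gk_poly_s13 x h hx hh (fun u => L * (u - x) ^ 2) (L * x ^ 2) (-2 * L * x) L 0 0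
      (fun u => by ring)
    have := gk_bound x h hx hh (fun u => (u - x) * p u) _ _ (by fun_prop) iq (by fun_prop) ir
      (fun u hu => by
        have := (hT u hu).1
        rw [show (u - x) * p u - a * (u - x) = (u - x) * (p u - a) by ring, abs_mul]
        calc |u - x| * |p u - a| ≤ |u - x| * (L * |u - x|) := by gcongr
          _ = L * |u - x| ^ 2 := by ring
          _ = L * (u - x) ^ 2 := by rw [sq_abs])
    rw [vq, vr] at this
    convert this using 1
    · congr 1; ring
    · ring
  have A2 : ∀ h : ℝ, 0 < h → |Egamma x h (fun u => (u - x) ^ 2 * p u) -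
      (a * (x * h + 2 * h ^ 2) + d * (5 * x * h ^ 2 + 6 * h ^ 3))| ≤
      M * (3 * x ^ 2 * h ^ 2 + 26 * x * h ^ 3 + 24 * h ^ 4) := by
    intro h hh
    obtain ⟨iq, vq⟩ := gk_poly_s13 x h hx hh (fun u => a * (u - x) ^ 2 + d * (u - x) ^ 3)
      (a * x ^ 2 - d * x ^ 3) (-2 * a * x + 3 * d * x ^ 2) (a - 3 * d * x) d 0
      (fun u => by ring)
    obtain ⟨ir, vr⟩ := gk_poly_s13 x h hx hh (fun u => M * (u - x) ^ 4)
      (M * x ^ 4) (-4 * M * x ^ 3) (6 * M * x ^ 2) (-4 * M * x) M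
      (fun u => by ring)
    have := gk_bound x h hx hh (fun u => (u - x) ^ 2 * p u) _ _ (by fun_prop) iq (by fun_prop) ir
      (fun u hu => by
        have := (hT u hu).2
        rw [show (u - x) ^ 2 * p u - (a * (u - x) ^ 2 + d * (u - x) ^ 3) =
          (u - x) ^ 2 * (p u - a - d * (u - x)) by ring, abs_mul, abs_of_nonneg (sq_nonneg (u - x))]
        calc (u - x) ^ 2 * |p u - a - d * (u - x)| ≤ (u - x) ^ 2 * (M * (u - x) ^ 2) := by gcongr
          _ = M * (u - x) ^ 4 := by ring)
    rw [vq, vr] at this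
    convert this using 1
    · congr 1; ring
    · ring
  -- combine, with `h < 1`
  obtain ⟨B0, hB0, B0'⟩ : ∃ B, 0 ≤ B ∧ ∀ h : ℝ, 0 < h → h < 1 → |Egamma x h p - a| ≤ B * h := by
    refine ⟨|d| + M * (x + 2), by positivity, fun h hh h1 => ?_⟩
    have := A0 h hh
    calc |Egamma x h p - a| = |(Egamma x h p - (a + d * h)) + d * h| := by congr 1; ring
      _ ≤ M * (x * h + 2 * h ^ 2) + |d| * h := by
        refine (abs_add_le _ _).trans (add_le_add this ?_)
        rw [abs_mul, abs_of_pos hh]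
      _ ≤ M * (x * h + 2 * h) + |d| * h := by
        gcongr; nlinarith
      _ = _ := by ring
  obtain ⟨B1, hB1, B1'⟩ : ∃ B, 0 ≤ B ∧ ∀ h : ℝ, 0 < h → h < 1 →
      |Egamma x h (fun u => (u - x) * p u)| ≤ B * h := by
    refine ⟨|a| + L * (x + 2), by positivity, fun h hh h1 => ?_⟩
    have := A1 h hh
    calc |Egamma x h (fun u => (u - x) * p u)|
        = |(Egamma x h (fun u => (u - x) * p u) - a * h) + a * h| := by congr 1; ring
      _ ≤ L * (x * h + 2 * h ^ 2) + |a| * h := by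
        refine (abs_add_le _ _).trans (add_le_add this ?_)
        rw [abs_mul, abs_of_pos hh]
      _ ≤ L * (x * h + 2 * h) + |a| * h := by
        gcongr; nlinarith
      _ = _ := by ring
  obtain ⟨B2, hB2, B2'⟩ : ∃ B, 0 ≤ B ∧ ∀ h : ℝ, 0 < h → h < 1 →
      |Egamma x h (fun u => (u - x) ^ 2 * p u) - a * x * h| ≤ B * h ^ 2 := by
    refine ⟨2 * |a| + |d| * (5 * x + 6) + M * (3 * x ^ 2 + 26 * x + 24), by positivity,
      fun h hh h1 => ?_⟩
    have := A2 h hh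
    have h3 : h ^ 3 ≤ h ^ 2 := pow_le_pow_of_le_one hh.le h1.le (by norm_num)
    have h4 : h ^ 4 ≤ h ^ 2 := pow_le_pow_of_le_one hh.le h1.le (by norm_num)
    calc |Egamma x h (fun u => (u - x) ^ 2 * p u) - a * x * h|
        = |(Egamma x h (fun u => (u - x) ^ 2 * p u) -
            (a * (x * h + 2 * h ^ 2) + d * (5 * x * h ^ 2 + 6 * h ^ 3))) +
            (a * (2 * h ^ 2) + d * (5 * x * h ^ 2 + 6 * h ^ 3))| := by congr 1; ring
      _ ≤ M * (3 * x ^ 2 * h ^ 2 + 26 * x * h ^ 3 + 24 * h ^ 4) +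
          (|a| * (2 * h ^ 2) + |d| * (5 * x * h ^ 2 + 6 * h ^ 3)) := by
        refine (abs_add_le _ _).trans (add_le_add this ((abs_add_le _ _).trans (le_of_eq ?_)))
        rw [abs_mul a, abs_mul d, abs_of_nonneg (by positivity : 0 ≤ 2 * h ^ 2),
          abs_of_nonneg (by positivity : 0 ≤ 5 * x * h ^ 2 + 6 * h ^ 3)]
      _ ≤ M * (3 * x ^ 2 * h ^ 2 + 26 * x * h ^ 2 + 24 * h ^ 2) +
          (|a| * (2 * h ^ 2) + |d| * (5 * x * h ^ 2 + 6 * h ^ 2)) := by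
        gcongr
      _ = _ := by ring
  refine ⟨B0 * (B2 + |a| * x) + |a| * B2 + B1 ^ 2 + 1, by positivity, 1, one_pos,
    fun h hh h1 => ?_⟩
  have b0 := B0' h hh h1
  have b1 := B1' h hh h1
  have b2 := B2' h hh h1
  generalize Egamma x h p = e0 at *
  generalize Egamma x h (fun u => (u - x) * p u) = e1 at *
  generalize Egamma x h (fun u => (u - x) ^ 2 * p u) = e2 at *
  have b2' : |e2| ≤ (B2 + |a| * x) * h := by
    calc |e2| = |(e2 - a * x * h) + a * x * h| := by congr 1; ring
      _ ≤ B2 * h ^ 2 + |a| * x * h := by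
        refine (abs_add_le _ _).trans (add_le_add b2 ?_)
        rw [abs_mul, abs_mul, abs_of_pos hh, abs_of_pos hx]
      _ ≤ B2 * h + |a| * x * h := by gcongr; nlinarith
      _ = _ := by ring
  calc |e0 * e2 - e1 ^ 2 - a ^ 2 * x * h|
      = |(e0 - a) * e2 + a * (e2 - a * x * h) + -(e1 ^ 2)| := by congr 1; ring
    _ ≤ |e0 - a| * |e2| + |a| * |e2 - a * x * h| + |e1| ^ 2 := by
      refine (abs_add_le _ _).trans (add_le_add ((abs_add_le _ _).trans (le_of_eq ?_)) ?_)
      · rw [abs_mul, abs_mul]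
      · rw [abs_neg, abs_pow]
    _ ≤ (B0 * h) * ((B2 + |a| * x) * h) + |a| * (B2 * h ^ 2) + (B1 * h) ^ 2 := by gcongr
    _ ≤ _ := by nlinarith [sq_nonneg h]
end

section
/- Let x > 0 and let φ : (0,∞) → ℝ be bounded, continuous and nonnegative. Then for every h > 0, h·∫₀^∞ | d/du K_{G(x/h+1,h)}(u) | φ(u) du ≤ ∫₀^∞ K_{G(x/h,h)}(u) φ(u) du + ∫₀^∞ K_{G(x/h+1,h)}(u) φ(u) du; moreover each of the two integrals on the right-hand side converges to φ(x) as h → 0⁺, and consequently limsup_{h→0⁺} h·∫₀^∞ | d/du K_{G(x/h+1,h)}(u) | φ(u) du ≤ 2 φ(x). -/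
open Real Filter Set MeasureTheory Topology

lemma gk_integral {a t : ℝ} (ha : 0 < a) (ht : 0 < t) :
    ∫ u in Ioi (0:ℝ), gammaKernel a t u = 1 := by
  have h := Real.integral_rpow_mul_exp_neg_mul_Ioi ha (inv_pos.2 ht)
  have hG := Real.Gamma_pos_of_pos ha
  have ht' : 0 < t ^ a := Real.rpow_pos_of_pos ht a
  unfold gammaKernel
  rw [integral_div]
  have : (∫ u in Ioi (0:ℝ), u ^ (a - 1) * Real.exp (-u / t)) = t ^ a * Real.Gamma a := by
    rw [show t ^ a = (1 / t⁻¹) ^ a by simp, ← h]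
    congr 1
    ext u
    congr 2
    field_simp
  rw [this]
  field_simp

lemma gk_integrable {a t : ℝ} (ha : 0 < a) (ht : 0 < t) :
    IntegrableOn (gammaKernel a t) (Ioi 0) := by
  by_contra hc
  have := gk_integral ha ht
  rw [integral_undef hc] at this
  norm_num at this

lemma gk_nonneg {a t u : ℝ} (ha : 0 < a) (ht : 0 < t) (hu : 0 < u) : 0 ≤ gammaKernel a t u := by
  have hG := Real.Gamma_pos_of_pos ha
  unfold gammaKernel
  positivity

lemma gk_mul {a t u : ℝ} (ha : 0 < a) (ht : 0 < t) (hu : 0 < u) :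
    u * gammaKernel a t u = a * t * gammaKernel (a + 1) t u := by
  have hG := Real.Gamma_pos_of_pos ha
  have ht' : 0 < t ^ a := Real.rpow_pos_of_pos ht a
  unfold gammaKernel
  rw [Real.Gamma_add_one ha.ne', Real.rpow_add_one ht.ne',
    show a + 1 - 1 = (a - 1) + 1 by ring, Real.rpow_add_one hu.ne']
  field_simp

lemma gk_deriv {a t u : ℝ} (ha : 0 < a) (ht : 0 < t) (hu : 0 < u) :
    t * deriv (gammaKernel (a + 1) t) u = gammaKernel a t u - gammaKernel (a + 1) t u := by
  have hG := Real.Gamma_pos_of_pos ha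
  have ht' : 0 < t ^ a := Real.rpow_pos_of_pos ht a
  have h1 : HasDerivAt (fun u : ℝ => u ^ (a + 1 - 1)) ((a + 1 - 1) * u ^ (a + 1 - 1 - 1)) u :=
    Real.hasDerivAt_rpow_const (Or.inl hu.ne')
  have h2 : HasDerivAt (fun u : ℝ => Real.exp (-u / t)) (Real.exp (-u / t) * (-1 / t)) u :=
    ((hasDerivAt_id u).neg.div_const t).exp
  have h3 := (h1.mul h2).div_const (t ^ (a + 1) * Real.Gamma (a + 1))
  have h4 : deriv (gammaKernel (a + 1) t) u = _ := h3.deriv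
  rw [h4]
  unfold gammaKernel
  rw [Real.Gamma_add_one ha.ne', Real.rpow_add_one ht.ne', show a + 1 - 1 = a by ring]
  field_simp
  ring

lemma gk_integrable_mul {a t M : ℝ} (ha : 0 < a) (ht : 0 < t) {φ : ℝ → ℝ}
    (hφc : ContinuousOn φ (Ioi 0)) (hM : ∀ u ∈ Ioi (0:ℝ), |φ u| ≤ M) :
    IntegrableOn (fun u => gammaKernel a t u * φ u) (Ioi 0) := by
  refine Integrable.mul_bdd (c := M) (gk_integrable ha ht) (hφc.aestronglyMeasurable measurableSet_Ioi) ?_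
  exact (ae_restrict_iff' measurableSet_Ioi).2 (Eventually.of_forall hM)

lemma gk_second {a t x u : ℝ} (ha : 0 < a) (ht : 0 < t) (hu : 0 < u) :
    gammaKernel a t u * (u - x) ^ 2 =
      (a * t) * ((a + 1) * t) * gammaKernel (a + 1 + 1) t u
        - 2 * x * (a * t) * gammaKernel (a + 1) t u + x ^ 2 * gammaKernel a t u := by
  have h1 := gk_mul ha ht hu
  have h2 := gk_mul (add_pos ha one_pos) ht hu
  linear_combination (u - 2 * x) * h1 + a * t * h2

lemma gk_approx {a t x M ε δ : ℝ} (ha : 0 < a) (ht : 0 < t) (hx : 0 < x) (hδ : 0 < δ)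
    (hε : 0 < ε) {φ : ℝ → ℝ}
    (hφc : ContinuousOn φ (Ioi 0)) (hM : ∀ u ∈ Ioi (0:ℝ), |φ u| ≤ M)
    (hd : ∀ u ∈ Ioi (0:ℝ), |u - x| < δ → |φ u - φ x| ≤ ε) :
    |(∫ u in Ioi (0:ℝ), gammaKernel a t u * φ u) - φ x| ≤
      ε + 2 * M / δ ^ 2 * ((a * t) * ((a + 1) * t) - 2 * x * (a * t) + x ^ 2) := by
  have ha1 : 0 < a + 1 := by linarith
  have ha2 : 0 < a + 1 + 1 := by linarith
  have i0 := gk_integrable ha ht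
  have i1 := gk_integrable ha1 ht
  have i2 := gk_integrable ha2 ht
  have e0 := gk_integral ha ht
  have e1 := gk_integral ha1 ht
  have e2 := gk_integral ha2 ht
  have iφ := gk_integrable_mul ha ht hφc hM
  have hM0 : 0 ≤ M := (abs_nonneg _).trans (hM x hx)
  set C := 2 * M / δ ^ 2 with hC
  have hC0 : 0 ≤ C := by positivity
  have key : (∫ u in Ioi (0:ℝ), gammaKernel a t u * φ u) - φ x =
      ∫ u in Ioi (0:ℝ), (gammaKernel a t u * φ u - gammaKernel a t u * φ x) := by
    rw [integral_sub iφ (i0.mul_const _), integral_mul_const, e0, one_mul]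
  let g : ℝ → ℝ := fun u => ε * gammaKernel a t u +
    C * ((a * t) * ((a + 1) * t) * gammaKernel (a + 1 + 1) t u
        - 2 * x * (a * t) * gammaKernel (a + 1) t u + x ^ 2 * gammaKernel a t u)
  have j0 : IntegrableOn (fun u => ε * gammaKernel a t u) (Ioi 0) := i0.const_mul _
  have j1 : IntegrableOn (fun u => (a * t) * ((a + 1) * t) * gammaKernel (a + 1 + 1) t u) (Ioi 0) :=
    i2.const_mul _
  have j2 : IntegrableOn (fun u => 2 * x * (a * t) * gammaKernel (a + 1) t u) (Ioi 0) :=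
    i1.const_mul _
  have j3 : IntegrableOn (fun u => x ^ 2 * gammaKernel a t u) (Ioi 0) := i0.const_mul _
  have j12 : IntegrableOn (fun u => (a * t) * ((a + 1) * t) * gammaKernel (a + 1 + 1) t u
        - 2 * x * (a * t) * gammaKernel (a + 1) t u) (Ioi 0) := j1.sub j2
  have j123 : IntegrableOn (fun u => (a * t) * ((a + 1) * t) * gammaKernel (a + 1 + 1) t u
        - 2 * x * (a * t) * gammaKernel (a + 1) t u + x ^ 2 * gammaKernel a t u) (Ioi 0) :=
    j12.add j3
  have ig : IntegrableOn g (Ioi 0) := j0.add (j123.const_mul C)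
  have eg : ∫ u in Ioi (0:ℝ), g u =
      ε + C * ((a * t) * ((a + 1) * t) - 2 * x * (a * t) + x ^ 2) := by
    rw [integral_add j0 (j123.const_mul C), integral_const_mul, integral_const_mul,
      integral_add j12 j3, integral_sub j1 j2, integral_const_mul, integral_const_mul,
      integral_const_mul, e0, e1, e2]
    ring
  rw [key, ← eg, ← Real.norm_eq_abs]
  refine norm_integral_le_of_norm_le ig ?_
  refine (ae_restrict_iff' measurableSet_Ioi).2 (Eventually.of_forall fun u hu => ?_)
  have hK := gk_nonneg ha ht hu
  have hb : |φ u - φ x| ≤ ε + C * (u - x) ^ 2 := by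
    by_cases h : |u - x| < δ
    · have := hd u hu h
      have : 0 ≤ C * (u - x) ^ 2 := by positivity
      linarith
    · push Not at h
      have h1 : δ ^ 2 ≤ (u - x) ^ 2 := by
        rw [← sq_abs (u - x)]; gcongr
      have h2 : 2 * M ≤ C * (u - x) ^ 2 := by
        calc 2 * M = C * δ ^ 2 := by rw [hC]; field_simp
          _ ≤ _ := by gcongr
      have h3 := abs_sub (φ u) (φ x)
      have h4 := hM u hu
      have h5 := hM x hx
      linarith
  have hg : g u = gammaKernel a t u * (ε + C * (u - x) ^ 2) := by
    have := gk_second (x := x) ha ht hu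
    simp only [g]
    rw [← this]; ring
  rw [hg, ← mul_sub, Real.norm_eq_abs, abs_mul, abs_of_nonneg hK]
  gcongr

lemma gk_tendsto {x : ℝ} (hx : 0 < x) {φ : ℝ → ℝ} (hφc : ContinuousOn φ (Ioi 0))
    (hφb : ∃ M, ∀ u ∈ Ioi (0:ℝ), |φ u| ≤ M) (a : ℝ → ℝ) (ha : ∀ h, 0 < h → 0 < a h)
    (hl : Tendsto (fun h => a h * h) (𝓝[>] 0) (𝓝 x)) :
    Tendsto (fun h : ℝ => ∫ u in Ioi (0:ℝ), gammaKernel (a h) h u * φ u) (𝓝[>] 0) (𝓝 (φ x)) := by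
  obtain ⟨M, hM⟩ := hφb
  rw [Metric.tendsto_nhds]
  intro ε hε
  have hca : ContinuousAt φ x := hφc.continuousAt (Ioi_mem_nhds hx)
  obtain ⟨δ, hδ, hd⟩ := Metric.continuousAt_iff.1 hca (ε / 2) (by positivity)
  have hid : Tendsto (fun h : ℝ => h) (𝓝[>] 0) (𝓝 0) := tendsto_nhdsWithin_of_tendsto_nhds tendsto_id
  have hV : Tendsto (fun h => ε / 2 + 2 * M / δ ^ 2 *
      ((a h * h) * (a h * h + h) - 2 * x * (a h * h) + x ^ 2)) (𝓝[>] 0)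
      (𝓝 (ε / 2 + 2 * M / δ ^ 2 * (x * (x + 0) - 2 * x * x + x ^ 2))) :=
    ((((hl.mul (hl.add hid)).sub (hl.const_mul (2 * x))).add_const _).const_mul _).const_add _
  have h0 : ε / 2 + 2 * M / δ ^ 2 * (x * (x + 0) - 2 * x * x + x ^ 2) < ε := by
    have : x * (x + 0) - 2 * x * x + x ^ 2 = 0 := by ring
    rw [this]; linarith
  filter_upwards [hV.eventually_lt_const h0, self_mem_nhdsWithin] with h h1 hh
  rw [Real.dist_eq]
  refine lt_of_le_of_lt (gk_approx (ha h hh) hh hx hδ (half_pos hε) hφc hM ?_) ?_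
  · intro u _ hu
    have := hd (x := u) (by rwa [Real.dist_eq])
    rw [Real.dist_eq] at this
    exact this.le
  · rwa [show (a h + 1) * h = a h * h + h by ring]

/-- For `x > 0` and `φ : (0,∞) → ℝ` bounded, continuous and nonnegative:
for every `h > 0`,
`h·∫₀^∞ |d/du K_{G(x/h+1,h)}(u)| φ(u) du
  ≤ ∫₀^∞ K_{G(x/h,h)}(u) φ(u) du + ∫₀^∞ K_{G(x/h+1,h)}(u) φ(u) du`;
each integral on the right converges to `φ(x)` as `h → 0⁺`; and consequently
`limsup_{h→0⁺} h·∫₀^∞ |d/du K_{G(x/h+1,h)}(u)| φ(u) du ≤ 2 φ(x)`. -/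
theorem gammaKernel_deriv_weighted_bound (x : ℝ) (hx : 0 < x) (φ : ℝ → ℝ)
    (hφc : ContinuousOn φ (Set.Ioi 0))
    (hφb : ∃ M, ∀ u ∈ Set.Ioi (0:ℝ), |φ u| ≤ M)
    (hφ0 : ∀ u ∈ Set.Ioi (0:ℝ), 0 ≤ φ u) :
    (∀ h : ℝ, 0 < h →
      h * ∫ u in Set.Ioi (0:ℝ), |deriv (gammaKernel (x / h + 1) h) u| * φ u ≤
        (∫ u in Set.Ioi (0:ℝ), gammaKernel (x / h) h u * φ u) +
          ∫ u in Set.Ioi (0:ℝ), gammaKernel (x / h + 1) h u * φ u) ∧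
    Filter.Tendsto (fun h : ℝ => ∫ u in Set.Ioi (0:ℝ), gammaKernel (x / h) h u * φ u)
      (nhdsWithin 0 (Set.Ioi 0)) (nhds (φ x)) ∧
    Filter.Tendsto (fun h : ℝ => ∫ u in Set.Ioi (0:ℝ), gammaKernel (x / h + 1) h u * φ u)
      (nhdsWithin 0 (Set.Ioi 0)) (nhds (φ x)) ∧
    Filter.limsup
        (fun h : ℝ => h * ∫ u in Set.Ioi (0:ℝ), |deriv (gammaKernel (x / h + 1) h) u| * φ u)
        (nhdsWithin 0 (Set.Ioi 0)) ≤ 2 * φ x := by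
  have A : ∀ h : ℝ, 0 < h →
      h * ∫ u in Set.Ioi (0:ℝ), |deriv (gammaKernel (x / h + 1) h) u| * φ u ≤
        (∫ u in Set.Ioi (0:ℝ), gammaKernel (x / h) h u * φ u) +
          ∫ u in Set.Ioi (0:ℝ), gammaKernel (x / h + 1) h u * φ u := by
    intro h hh
    obtain ⟨M, hM⟩ := hφb
    have ha : 0 < x / h := by positivity
    have ha1 : 0 < x / h + 1 := by positivity
    have i0 := gk_integrable_mul ha hh hφc hM
    have i1 := gk_integrable_mul ha1 hh hφc hM
    rw [← integral_const_mul, ← integral_add i0 i1]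
    refine integral_mono_of_nonneg ?_ (i0.add i1) ?_
    · refine (ae_restrict_iff' measurableSet_Ioi).2 (Eventually.of_forall fun u hu => ?_)
      exact mul_nonneg hh.le (mul_nonneg (abs_nonneg _) (hφ0 u hu))
    · refine (ae_restrict_iff' measurableSet_Ioi).2 (Eventually.of_forall fun u hu => ?_)
      have hd := gk_deriv ha hh hu
      have k0 := gk_nonneg ha hh hu
      have k1 := gk_nonneg ha1 hh hu
      have : h * |deriv (gammaKernel (x / h + 1) h) u| ≤
          gammaKernel (x / h) h u + gammaKernel (x / h + 1) h u := by
        rw [← abs_of_pos hh, ← abs_mul, abs_of_pos hh, hd, abs_le]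
        constructor <;> linarith
      have := mul_le_mul_of_nonneg_right this (hφ0 u hu)
      simp only
      linarith
  have hid : Tendsto (fun h : ℝ => h) (𝓝[>] 0) (𝓝 0) :=
    tendsto_nhdsWithin_of_tendsto_nhds tendsto_id
  have B := gk_tendsto hx hφc hφb (fun h => x / h) (fun h hh => by positivity) (by
    refine tendsto_const_nhds.congr' ?_
    filter_upwards [self_mem_nhdsWithin] with h hh
    have : h ≠ 0 := (mem_Ioi.1 hh).ne'
    field_simp)
  have C := gk_tendsto hx hφc hφb (fun h => x / h + 1) (fun h hh => by positivity) (by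
    have h1 : Tendsto (fun h : ℝ => x + h) (𝓝[>] 0) (𝓝 (x + 0)) := hid.const_add x
    rw [add_zero] at h1
    refine h1.congr' ?_
    filter_upwards [self_mem_nhdsWithin] with h hh
    have : h ≠ 0 := (mem_Ioi.1 hh).ne'
    field_simp)
  refine ⟨A, B, C, ?_⟩
  have D := B.add C
  rw [← two_mul] at D
  rw [← D.limsup_eq]
  refine limsup_le_limsup ?_ ?_ D.isBoundedUnder_le
  · filter_upwards [self_mem_nhdsWithin] with h hh using A h hh
  · refine IsBoundedUnder.isCoboundedUnder_le (isBoundedUnder_of_eventually_ge (a := 0) ?_)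
    filter_upwards [self_mem_nhdsWithin] with h hh
    exact mul_nonneg (mem_Ioi.1 hh).le (setIntegral_nonneg measurableSet_Ioi fun u hu =>
      mul_nonneg (abs_nonneg _) (hφ0 u hu))
end
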